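/- Let R be an M×N complex matrix with singular values σ₁ ≥ σ₂ ≥ … ≥ σ_{min(M,N)} ≥ 0 listed in decreasing order, and let 0 ≤ K ≤ min(M,N). Then for all column-orthonormal matrices X ∈ ℂ^{M×K} (XᴴX = I_K) and Y ∈ ℂ^{N×K} (YᴴY = I_K), the real part of tr(XᴴRY) satisfies Re tr(XᴴRY) ≤ σ₁ + σ₂ + … + σ_K. -/

import Mathlib

open Matrix

/-- A weighted sum of a decreasing nonnegative sequence, with weights in `[0, 1]` of total mass at
most `K`, is at most the sum of the first `K` terms. -/
theorem Antitone.sum_mul_le_sum_castLE {N K : ℕ} (hK : K ≤ N) {s c : Fin N → ℝ}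
    (hs : Antitone s) (hs0 : ∀ j, 0 ≤ s j) (hc0 : ∀ j, 0 ≤ c j) (hc1 : ∀ j, c j ≤ 1)
    (hc : ∑ j, c j ≤ K) : ∑ j, s j * c j ≤ ∑ k : Fin K, s (Fin.castLE hK k) := by
  obtain ⟨L, rfl⟩ := Nat.exists_eq_add_of_le hK
  obtain ⟨t, ht0, htl, htr⟩ : ∃ t : ℝ, 0 ≤ t ∧ (∀ i : Fin K, t ≤ s (Fin.castAdd L i)) ∧
      ∀ i : Fin L, s (Fin.natAdd K i) ≤ t := by
    rcases L with _ | L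
    · exact ⟨0, le_rfl, fun i => hs0 _, fun i => i.elim0⟩
    · refine ⟨s (Fin.natAdd K 0), hs0 _, fun i => hs ?_, fun i => hs ?_⟩
      · simp only [Fin.le_def, Fin.val_castAdd, Fin.val_natAdd]; omega
      · simp [Fin.le_def]
  rw [Fin.sum_univ_add] at hc ⊢
  have hl : ∑ i : Fin K, s (Fin.castAdd L i) * c (Fin.castAdd L i) ≤
      ∑ i : Fin K, (s (Fin.castAdd L i) + t * (c (Fin.castAdd L i) - 1)) :=
    Finset.sum_le_sum fun i _ => by nlinarith [htl i, hc1 (Fin.castAdd L i)]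
  have hr : ∑ i : Fin L, s (Fin.natAdd K i) * c (Fin.natAdd K i) ≤
      ∑ i : Fin L, t * c (Fin.natAdd K i) :=
    Finset.sum_le_sum fun i _ => mul_le_mul_of_nonneg_right (htr i) (hc0 _)
  rw [Finset.sum_add_distrib, ← Finset.mul_sum, Finset.sum_sub_distrib] at hl
  rw [← Finset.mul_sum] at hr
  simp only [Finset.sum_const, Finset.card_univ, Fintype.card_fin, nsmul_eq_mul, mul_one] at hl
  have hcast : ∑ k : Fin K, s (Fin.castLE hK k) = ∑ k : Fin K, s (Fin.castAdd L k) := rfl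
  rw [hcast]
  nlinarith [mul_le_mul_of_nonneg_left hc ht0]

namespace Matrix

variable {m n k : Type*} [Fintype m]

theorem conjTranspose_mul_self_apply_self (A : Matrix m n ℂ) (j : n) :
    (Aᴴ * A) j j = ((∑ i, ‖A i j‖ ^ 2 : ℝ) : ℂ) := by
  simp [mul_apply, Complex.conj_mul']

theorem norm_conjTranspose_mul_apply_comm (X : Matrix m k ℂ) (A : Matrix m n ℂ) (l : k) (j : n) :
    ‖(Xᴴ * A) l j‖ = ‖(Aᴴ * X) j l‖ := by
  rw [← norm_star, ← conjTranspose_apply, conjTranspose_mul, conjTranspose_conjTranspose]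

variable [Fintype n]

/-- Bessel's inequality for a partial isometry. -/
theorem sum_norm_sq_conjTranspose_mul_le {A : Matrix m n ℂ} (hA : A * Aᴴ * A = A)
    (C : Matrix m k ℂ) (l : k) : ∑ j, ‖(Aᴴ * C) j l‖ ^ 2 ≤ ∑ i, ‖C i l‖ ^ 2 := by
  have h : (C - A * (Aᴴ * C))ᴴ * (C - A * (Aᴴ * C)) + (Aᴴ * C)ᴴ * (Aᴴ * C) = Cᴴ * C := by
    have h' : Cᴴ * (A * (Aᴴ * (A * (Aᴴ * C)))) = Cᴴ * (A * (Aᴴ * C)) := by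
      simpa only [Matrix.mul_assoc] using congrArg (fun M => Cᴴ * (M * (Aᴴ * C))) hA
    simp only [conjTranspose_sub, conjTranspose_mul, conjTranspose_conjTranspose,
      Matrix.sub_mul, Matrix.mul_sub, Matrix.mul_assoc, h']
    abel
  have h₁ := congrFun (congrFun h l) l
  rw [add_apply, conjTranspose_mul_self_apply_self, conjTranspose_mul_self_apply_self,
    conjTranspose_mul_self_apply_self] at h₁
  norm_cast at h₁
  rw [← h₁]
  exact le_add_of_nonneg_left (by positivity)

theorem sum_norm_sq_col_le_one {A : Matrix m n ℂ} (hA : A * Aᴴ * A = A) (j : n) :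
    ∑ i, ‖A i j‖ ^ 2 ≤ 1 := by
  classical
  have hA' : Aᴴ * Aᴴᴴ * Aᴴ = Aᴴ := by
    simpa [Matrix.mul_assoc] using congrArg conjTranspose hA
  have h := sum_norm_sq_conjTranspose_mul_le hA' (1 : Matrix n n ℂ) j
  have h1 : ∑ i, ‖(1 : Matrix n n ℂ) i j‖ ^ 2 = 1 := by
    rw [Finset.sum_eq_single j] <;> simp +contextual
  simpa [h1] using h

theorem sum_norm_sq_conjTranspose_mul_row_le_one [Fintype k] [DecidableEq k]
    {A : Matrix m n ℂ} (hA : A * Aᴴ * A = A) {X : Matrix m k ℂ} (hX : Xᴴ * X = 1) (j : n) :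
    ∑ l, ‖(Aᴴ * X) j l‖ ^ 2 ≤ 1 := by
  have h := sum_norm_sq_conjTranspose_mul_le (A := X)
    (by rw [Matrix.mul_assoc, hX, Matrix.mul_one]) A j
  simp only [norm_conjTranspose_mul_apply_comm X A] at h
  exact h.trans (sum_norm_sq_col_le_one hA j)

theorem sum_sum_norm_sq_conjTranspose_mul_le [Fintype k] [DecidableEq k]
    {A : Matrix m n ℂ} (hA : A * Aᴴ * A = A) {X : Matrix m k ℂ} (hX : Xᴴ * X = 1) :
    ∑ j, ∑ l, ‖(Aᴴ * X) j l‖ ^ 2 ≤ Fintype.card k := by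
  rw [Finset.sum_comm]
  calc ∑ l, ∑ j, ‖(Aᴴ * X) j l‖ ^ 2 ≤ ∑ _l : k, (1 : ℝ) := Finset.sum_le_sum fun l _ =>
        (sum_norm_sq_conjTranspose_mul_le hA X l).trans <|
          sum_norm_sq_col_le_one (by rw [Matrix.mul_assoc, hX, Matrix.mul_one]) l
    _ = Fintype.card k := by simp

/-- Polar-type factorization: a matrix with orthogonal columns is a partial isometry with its
columns rescaled. -/
theorem exists_partialIsometry_mul_diagonal [DecidableEq n] {B : Matrix m n ℂ} {s : n → ℝ}
    (hB : Bᴴ * B = diagonal fun j => ((s j ^ 2 : ℝ) : ℂ)) :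
    ∃ U : Matrix m n ℂ, U * Uᴴ * U = U ∧ B = U * diagonal fun j => (s j : ℂ) := by
  refine ⟨B * diagonal fun j => ((s j)⁻¹ : ℂ), ?_, ?_⟩
  · have hD : (diagonal fun j => ((s j)⁻¹ : ℂ))ᴴ = diagonal fun j => ((s j)⁻¹ : ℂ) := by
      rw [diagonal_conjTranspose]
      congr 1
      ext j
      simp
    rw [conjTranspose_mul, hD, Matrix.mul_assoc, Matrix.mul_assoc (diagonal _),
      ← Matrix.mul_assoc Bᴴ, hB, Matrix.mul_assoc]
    simp only [diagonal_mul_diagonal]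
    congr 3
    ext j
    by_cases h : (s j : ℂ) = 0
    · simp [h]
    · push_cast
      field_simp
  · ext i j
    rw [Matrix.mul_assoc, diagonal_mul_diagonal, mul_diagonal]
    by_cases h : s j = 0
    · have h₁ := congrFun (congrFun hB j) j
      rw [conjTranspose_mul_self_apply_self, diagonal_apply_eq, h] at h₁
      rw [Complex.ofReal_inj, zero_pow two_ne_zero,
        Finset.sum_eq_zero_iff_of_nonneg (fun _ _ => by positivity)] at h₁
      have h₂ : B i j = 0 := by simpa using h₁ i (Finset.mem_univ i)
      simp [h₂]
    · have : (s j : ℂ) ≠ 0 := by exact_mod_cast h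
      simp [this]

theorem re_trace_conjTranspose_mul_diagonal_mul_le [Fintype k] [DecidableEq n]
    {s : n → ℝ} (hs : ∀ j, 0 ≤ s j) (P Q : Matrix n k ℂ) :
    (trace (Pᴴ * (diagonal (fun j => (s j : ℂ)) * Q))).re ≤
      ∑ j, s j * ((∑ l, ‖P j l‖ ^ 2 + ∑ l, ‖Q j l‖ ^ 2) / 2) := by
  have h : trace (Pᴴ * (diagonal (fun j => (s j : ℂ)) * Q)) =
      ∑ j, (s j : ℂ) * ∑ l, star (P j l) * Q j l := by
    simp only [trace, diag_apply, mul_apply (M := Pᴴ), diagonal_mul, conjTranspose_apply,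
      Finset.mul_sum]
    rw [Finset.sum_comm]
    exact Finset.sum_congr rfl fun j _ => Finset.sum_congr rfl fun l _ => by ring
  rw [h, Complex.re_sum]
  refine Finset.sum_le_sum fun j _ => ?_
  rw [Complex.re_ofReal_mul, Complex.re_sum]
  refine mul_le_mul_of_nonneg_left ?_ (hs j)
  rw [← Finset.sum_add_distrib, Finset.sum_div]
  refine Finset.sum_le_sum fun l _ => (Complex.re_le_norm _).trans ?_
  rw [norm_mul, norm_star]
  linarith [two_mul_le_add_sq ‖P j l‖ ‖Q j l‖]

/-- A Hermitian matrix is diagonalized by a unitary matrix, with its eigenvalues in any order. -/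
theorem IsHermitian.exists_unitary_conj_eq_diagonal [DecidableEq n] {A : Matrix n n ℂ}
    (hA : A.IsHermitian) (e : Equiv.Perm n) :
    ∃ V : Matrix n n ℂ, V * Vᴴ = 1 ∧
      Vᴴ * A * V = diagonal fun j => (hA.eigenvalues (e j) : ℂ) := by
  set W : Matrix n n ℂ := (hA.eigenvectorUnitary : Matrix n n ℂ) with hW
  have hWW : W * Wᴴ = 1 := Unitary.coe_mul_star_self hA.eigenvectorUnitary
  have hAW : Wᴴ * A * W = diagonal fun j => (hA.eigenvalues j : ℂ) := by
    have := hA.conjStarAlgAut_star_eigenvectorUnitary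
    rw [Unitary.conjStarAlgAut_apply] at this
    simpa [hW, Function.comp_def, star_eq_conjTranspose] using this
  refine ⟨W.submatrix id e, ?_, ?_⟩
  · rw [conjTranspose_submatrix, submatrix_mul_equiv, hWW, submatrix_id_id]
  · have h := congrArg (fun M => M.submatrix e e) hAW
    simp only [submatrix_diagonal_equiv] at h
    simpa [Matrix.submatrix_mul _ _ _ id _ Function.bijective_id, Function.comp_def] using h

end Matrix

/-- Upper-bound half of the bilinear Ky Fan theorem: if `R : ℂ^{M × N}` has singular
values `σ 0 ≥ σ 1 ≥ … ≥ σ (min M N - 1) ≥ 0` (the nonnegative square roots of the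
decreasingly-ordered eigenvalues `μ` of `Rᴴ R`), `K ≤ min M N`, and `X : ℂ^{M × K}`,
`Y : ℂ^{N × K}` are column-orthonormal, then `Re tr (Xᴴ R Y) ≤ σ 0 + ⋯ + σ (K-1)`. -/
theorem kyFan_singular_upper_bound {M N K : ℕ} (hK : K ≤ min M N)
    (R : Matrix (Fin M) (Fin N) ℂ)
    (hH : (Rᴴ * R).IsHermitian)
    (μ : Fin N → ℝ) (hμanti : Antitone μ)
    (hμ : ∃ e : Equiv.Perm (Fin N), μ = hH.eigenvalues ∘ e)
    (σ : Fin (min M N) → ℝ)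
    (hσ : ∀ k : Fin (min M N), σ k = Real.sqrt (μ (Fin.castLE (min_le_right M N) k)))
    (X : Matrix (Fin M) (Fin K) ℂ) (hX : Xᴴ * X = 1)
    (Y : Matrix (Fin N) (Fin K) ℂ) (hY : Yᴴ * Y = 1) :
    (Matrix.trace (Xᴴ * R * Y)).re ≤ ∑ k : Fin K, σ (Fin.castLE hK k) := by
  obtain ⟨e, rfl⟩ := hμ
  obtain ⟨V, hV, hVD⟩ := hH.exists_unitary_conj_eq_diagonal e
  set μ := hH.eigenvalues ∘ e
  have hμ0 (j : Fin N) : 0 ≤ μ j :=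
    eigenvalues_conjTranspose_mul_self_nonneg R (e j)
  set s : Fin N → ℝ := fun j => √(μ j)
  have hs0 (j : Fin N) : 0 ≤ s j := Real.sqrt_nonneg _
  have hs : Antitone s := fun i j hij => Real.sqrt_le_sqrt (hμanti hij)
  obtain ⟨U, hU, hRV⟩ := exists_partialIsometry_mul_diagonal (B := R * V) (s := s) (by
    rw [conjTranspose_mul, Matrix.mul_assoc, ← Matrix.mul_assoc Rᴴ, ← Matrix.mul_assoc, hVD]
    congr 1
    ext j
    rw [Real.sq_sqrt (hμ0 j)]
    rfl)
  have hV' : V * Vᴴ * V = V := by rw [hV, Matrix.one_mul]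
  have hR : Xᴴ * R * Y = (Uᴴ * X)ᴴ * (diagonal (fun j => (s j : ℂ)) * (Vᴴ * Y)) := by
    calc Xᴴ * R * Y = Xᴴ * (R * (V * Vᴴ)) * Y := by rw [hV, Matrix.mul_one]
      _ = Xᴴ * (R * V) * Vᴴ * Y := by simp only [Matrix.mul_assoc]
      _ = _ := by
        rw [hRV]
        simp only [conjTranspose_mul, conjTranspose_conjTranspose, Matrix.mul_assoc]
  rw [hR]
  refine (re_trace_conjTranspose_mul_diagonal_mul_le hs0 _ _).trans ?_
  refine (hs.sum_mul_le_sum_castLE (hK.trans (min_le_right M N)) hs0 (fun j => by positivity)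
    (fun j => ?_) ?_).trans_eq ?_
  · linarith [sum_norm_sq_conjTranspose_mul_row_le_one hU hX j,
      sum_norm_sq_conjTranspose_mul_row_le_one hV' hY j]
  · have hUX := sum_sum_norm_sq_conjTranspose_mul_le hU hX
    have hVY := sum_sum_norm_sq_conjTranspose_mul_le hV' hY
    rw [Fintype.card_fin] at hUX hVY
    rw [← Finset.sum_div, Finset.sum_add_distrib]
    linarith
  · exact Finset.sum_congr rfl fun k _ => (hσ (Fin.castLE hK k)).symm
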